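/- Let φ: S(V)⊗Λ(V) → S(V)⊗Λ(V) be the F_q-algebra homomorphism determined by φ(x_m) = 0, φ(x_i) = x_i for i ≠ m, and φ(y_i) = y_i for all i. Suppose 1 ≤ j ≤ m ≤ n and 0 ≤ b_1 < ⋯ < b_{j−1} < m−1. Then φ(M_{m;b_1,…,b_{j−1},m−1}) = (−1)^{m+j} · M_{m−1;b_1,…,b_{j−1}} · y_m, where for j = 1 the factor M_{m−1;∅} is the determinant det((x_t^{q^c})_{0 ≤ c ≤ m−2, 1 ≤ t ≤ m−1}). -/

import Mathlib

open scoped TensorProduct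
open MvPolynomial Finset

noncomputable section

/-- The symmetric algebra `S(V) = F[x_1,…,x_n]` of the natural module `V = F^n`. -/
abbrev SV (F : Type) [Field F] (n : ℕ) := MvPolynomial (Fin n) F

/-- The exterior algebra `Λ(V) = E[y_1,…,y_n]`. -/
abbrev LV (F : Type) [Field F] (n : ℕ) := ExteriorAlgebra F (Fin n → F)

/-- `S(V) ⊗ Λ(V)`. -/
abbrev SL (F : Type) [Field F] (n : ℕ) := SV F n ⊗[F] LV F n

/-- the variable `x_{a+1}` (0-indexed `a`), junk value `0` out of range. -/
def xV (F : Type) [Field F] (n a : ℕ) : SV F n :=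
  if h : a < n then X ⟨a, h⟩ else 0

/-- the exterior generator `y_{a+1}` (0-indexed `a`). -/
def yV (F : Type) [Field F] (n a : ℕ) : LV F n :=
  if h : a < n then ExteriorAlgebra.ι F (Pi.single (⟨a, h⟩ : Fin n) (1 : F)) else 0

/-- the product `y_{s_1} ⋯ y_{s_j}` over `S = {s_1 < ⋯ < s_j}` in increasing order. -/
def yProd (F : Type) [Field F] (n : ℕ) (S : Finset ℕ) : LV F n :=
  ((S.sort (· ≤ ·)).map (yV F n)).prod

/-- determinant of the matrix `(x_t^{q^c})` with rows indexed by `c ∈ R` in increasing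
order and columns by `t ∈ C` in increasing order; junk value `0` if sizes differ. -/
def subDet (F : Type) [Field F] (q n : ℕ) (R C : Finset ℕ) : SV F n :=
  if h : C.card = R.card then
    Matrix.det (Matrix.of fun i j : Fin R.card =>
      xV F n (C.orderEmbOfFin h j) ^ q ^ (R.orderEmbOfFin rfl i : ℕ))
  else 0

/-- Mui's element `M_{m;b_1,…,b_j}` where `B = {b_1 < ⋯ < b_j}` (0-indexed `b`'s);
for `B = ∅` this is the Moore determinant `det (x_t^{q^c})`. -/
def MuiM (F : Type) [Field F] (q n m : ℕ) (B : Finset ℕ) : SL F n :=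
  ∑ S ∈ (range m).powersetCard B.card,
    ((-1 : F) ^ (B.card * (B.card + 1) / 2 + (∑ s ∈ S, s) + B.card)) •
      (subDet F q n (range m \ B) (range m \ S) ⊗ₜ[F] yProd F n S)

/-- `∏_{c : F^a} (c_1 x_1 + ⋯ + c_a x_a + x_{t+1})` (0-indexed `t`). -/
def linProd (F : Type) [Field F] [Fintype F] (n a t : ℕ) : SV F n :=
  ∏ c : Fin a → F, ((∑ k : Fin a, MvPolynomial.C (c k) * xV F n k) + xV F n t)

/-- Dickson's `L_m = V_1 V_2 ⋯ V_m`. -/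
def Lm (F : Type) [Field F] [Fintype F] (n m : ℕ) : SV F n :=
  ∏ a ∈ range m, linProd F n a a

/-- The property characterizing the Dickson invariants `Q_{m,k}`:
`Q_{m,k} · L_m = L_{m,k}` in `F[x_1,…,x_m]`. -/
def DicksonProp (F : Type) [Field F] [Fintype F] (q : ℕ)
    (Q : (m : ℕ) → ℕ → SV F m) : Prop :=
  ∀ m k : ℕ, k ≤ m →
    Q m k * Lm F m m = subDet F q m (range (m + 1) \ {k}) (range m)

/-- action of a matrix on `S(V)` by linear substitution: `x_j ↦ ∑_i g_{ij} x_i`. -/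
def gAct (F : Type) [Field F] (n : ℕ) (g : Matrix (Fin n) (Fin n) F) :
    SV F n →ₐ[F] SV F n :=
  MvPolynomial.aeval fun j => ∑ i, MvPolynomial.C (g i j) * MvPolynomial.X i

/-- action of a matrix on `Λ(V)` by linear substitution: `y_j ↦ ∑_i g_{ij} y_i`. -/
def eAct (F : Type) [Field F] (n : ℕ) (g : Matrix (Fin n) (Fin n) F) :
    LV F n →ₐ[F] LV F n :=
  ExteriorAlgebra.map g.mulVecLin

/-- diagonal action of a matrix on `S(V) ⊗ Λ(V)`. -/
def tAct (F : Type) [Field F] (n : ℕ) (g : Matrix (Fin n) (Fin n) F) :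
    SL F n →ₐ[F] SL F n :=
  Algebra.TensorProduct.map (gAct F n g) (eAct F n g)

/-- the invariants of a set of matrices on `S(V) ⊗ Λ(V)`, as an `F`-subspace. -/
def invSL (F : Type) [Field F] (n : ℕ) (P : Set (Matrix (Fin n) (Fin n) F)) :
    Submodule F (SL F n) where
  carrier := {f | ∀ g ∈ P, tAct F n g f = f}
  add_mem' := fun ha hb g hg => by rw [map_add, ha g hg, hb g hg]
  zero_mem' := fun g hg => map_zero _
  smul_mem' := fun c f hf g hg => by rw [map_smul, hf g hg]

/-- the invariants of `S(V) ⊗ Λ(V) ⊗ Det^k`, i.e. elements with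
`det(g)^k (g·f) = f` for all `g ∈ P`. -/
def invSLtw (F : Type) [Field F] (n k : ℕ) (P : Set (Matrix (Fin n) (Fin n) F)) :
    Submodule F (SL F n) where
  carrier := {f | ∀ g ∈ P, g.det ^ k • tAct F n g f = f}
  add_mem' := fun ha hb g hg => by rw [map_add, smul_add, ha g hg, hb g hg]
  zero_mem' := fun g hg => by rw [map_zero, smul_zero]
  smul_mem' := fun c f hf g hg => by rw [map_smul, smul_comm, hf g hg]

/-- the invariants of a set of matrices on `S(V)`, as an `F`-subalgebra. -/
def invS (F : Type) [Field F] (n : ℕ) (P : Set (Matrix (Fin n) (Fin n) F)) :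
    Subalgebra F (SV F n) where
  carrier := {f | ∀ g ∈ P, gAct F n g f = f}
  mul_mem' := fun ha hb g hg => by rw [map_mul, ha g hg, hb g hg]
  one_mem' := fun g hg => map_one _
  add_mem' := fun ha hb g hg => by rw [map_add, ha g hg, hb g hg]
  zero_mem' := fun g hg => map_zero _
  algebraMap_mem' := fun c g hg => (gAct F n g).commutes c

/-- `v_{i,j+1}` (0-indexed `j`) for the composition `I`. -/
def vij (F : Type) [Field F] [Fintype F] (n : ℕ) (I : Composition n)
    (i : Fin I.length) (j : ℕ) : SV F n :=
  linProd F n (I.sizeUpTo i) (I.sizeUpTo i + j)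

/-- `θ_i = L_{n_i}(v_{i,1},…,v_{i,n_i})`. -/
def theta (F : Type) [Field F] [Fintype F] (n : ℕ) (I : Composition n)
    (i : Fin I.length) : SV F n :=
  MvPolynomial.aeval (fun t : Fin (I.blocksFun i) => vij F n I i t)
    (Lm F (I.blocksFun i) (I.blocksFun i))

/-- `q_{i,k} = Q_{n_i,k}(v_{i,1},…,v_{i,n_i})`, given the Dickson polynomials `Q`. -/
def qInv (F : Type) [Field F] [Fintype F] (n : ℕ) (Q : (m : ℕ) → ℕ → SV F m)
    (I : Composition n) (i : Fin I.length) (k : ℕ) : SV F n :=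
  MvPolynomial.aeval (fun t : Fin (I.blocksFun i) => vij F n I i t)
    (Q (I.blocksFun i) k)

/-- the index of the block (0-indexed) of the composition `I` containing `a`. -/
def blkIdx (n : ℕ) (I : Composition n) (a : ℕ) : ℕ :=
  ((range I.length).filter fun i => I.sizeUpTo (i + 1) ≤ a).card

/-- the parabolic subgroup `P_I`: invertible block upper-triangular matrices. -/
def PIset (F : Type) [Field F] (n : ℕ) (I : Composition n) :
    Set (Matrix (Fin n) (Fin n) F) :=
  {g | IsUnit g.det ∧ ∀ a b : Fin n, blkIdx n I b < blkIdx n I a → g a b = 0}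

/-- the subgroup `K_I ≤ P_I`: block upper-triangular with all diagonal blocks
of determinant `1`. -/
def KIset (F : Type) [Field F] (n : ℕ) (I : Composition n) :
    Set (Matrix (Fin n) (Fin n) F) :=
  {g | IsUnit g.det ∧ (∀ a b : Fin n, blkIdx n I b < blkIdx n I a → g a b = 0) ∧
    ∀ i : Fin I.length,
      Matrix.det (Matrix.of fun a b : Fin (I.blocksFun i) =>
        g (I.embedding i a) (I.embedding i b)) = 1}

/-- the unipotent subgroup `U_n` of uni-uppertriangular matrices. -/
def Uset (F : Type) [Field F] (n : ℕ) : Set (Matrix (Fin n) (Fin n) F) :=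
  {g | (∀ a b : Fin n, b < a → g a b = 0) ∧ ∀ a : Fin n, g a a = 1}

/-- `SL_n(q)`. -/
def SLset (F : Type) [Field F] (n : ℕ) : Set (Matrix (Fin n) (Fin n) F) :=
  {g | g.det = 1}

/-- `GL_n(q)`. -/
def GLset (F : Type) [Field F] (n : ℕ) : Set (Matrix (Fin n) (Fin n) F) :=
  {g | IsUnit g.det}

/-- the bigraded piece `S^i(V) ⊗ Λ^j(V)` of `S(V) ⊗ Λ(V)`. -/
def piece (F : Type) [Field F] (n i j : ℕ) : Submodule F (SL F n) :=
  LinearMap.range (TensorProduct.map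
    (MvPolynomial.homogeneousSubmodule (Fin n) F i).subtype
    (LinearMap.range (ExteriorAlgebra.ι F (M := Fin n → F)) ^ j).subtype)

/-- the Hilbert series in `ℤ[s][[t]]` of a bigraded subspace `W` of `S(V) ⊗ Λ(V)`:
the coefficient of `t^i` is `∑_{j=0}^n dim (W ∩ (S^i ⊗ Λ^j)) s^j`. -/
def Hser (F : Type) [Field F] (n : ℕ) (W : Submodule F (SL F n)) :
    PowerSeries (Polynomial ℤ) :=
  PowerSeries.mk fun i => ∑ j ∈ range (n + 1),
    Polynomial.C (Module.finrank F ↥(W ⊓ piece F n i j) : ℤ) * Polynomial.X ^ j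

/-- the Hilbert series in `ℤ[[t]]` of a graded subalgebra of `S(V)`. -/
def HserS (F : Type) [Field F] (n : ℕ) (W : Subalgebra F (SV F n)) :
    PowerSeries ℤ :=
  PowerSeries.mk fun d =>
    (Module.finrank F ↥(Subalgebra.toSubmodule W ⊓ MvPolynomial.homogeneousSubmodule (Fin n) F d) : ℤ)

/-- the index set for Mui-type basis elements attached to the composition `I`:
pairs `(i, B)` with `B = {b_1 < ⋯ < b_j} ⊆ {0,…,m_{i+1}−1}` nonempty and
`max B ≥ m_i` (0-indexed `i`). -/
def Adm (n : ℕ) (I : Composition n) : Finset (Fin I.length × Finset ℕ) :=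
  (Finset.univ ×ˢ (range n).powerset).filter fun x =>
    x.2 ⊆ range (I.sizeUpTo ((x.1 : ℕ) + 1)) ∧ x.2.Nonempty ∧ ∃ b ∈ x.2, I.sizeUpTo (x.1 : ℕ) ≤ b

/-- The substitution `x_{k+1} ↦ 0` on `S(V)`, fixing the other variables. -/
abbrev killVar (F : Type) [Field F] (n k : ℕ) : SV F n →ₐ[F] SV F n :=
  MvPolynomial.aeval fun i : Fin n => if (i : ℕ) = k then 0 else MvPolynomial.X i

theorem killVar_xV_self (F : Type) [Field F] (n k : ℕ) : killVar F n k (xV F n k) = 0 := by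
  unfold xV
  split_ifs <;> simp

theorem killVar_xV_of_ne (F : Type) [Field F] {n k a : ℕ} (h : a ≠ k) :
    killVar F n k (xV F n a) = xV F n a := by
  unfold xV
  split_ifs <;> simp [h]

theorem killVar_subDet_of_mem (F : Type) [Field F] {q n k : ℕ} (hq : q ≠ 0) (R : Finset ℕ)
    {C : Finset ℕ} (hk : k ∈ C) : killVar F n k (subDet F q n R C) = 0 := by
  unfold subDet
  split_ifs with h
  · obtain ⟨i, hi⟩ : ∃ i, C.orderEmbOfFin h i = k := by
      rw [← Set.mem_range, range_orderEmbOfFin]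
      exact hk
    rw [AlgHom.map_det]
    refine Matrix.det_eq_zero_of_column_eq_zero i fun a => ?_
    simp only [AlgHom.mapMatrix_apply, Matrix.map_apply, Matrix.of_apply, map_pow, hi,
      killVar_xV_self]
    exact zero_pow (pow_ne_zero _ hq)
  · exact map_zero _

theorem killVar_subDet_of_notMem (F : Type) [Field F] {q n k : ℕ} (R : Finset ℕ)
    {C : Finset ℕ} (hk : k ∉ C) : killVar F n k (subDet F q n R C) = subDet F q n R C := by
  unfold subDet
  split_ifs with h
  · rw [AlgHom.map_det]
    congr 1
    ext1 i a
    simp only [AlgHom.mapMatrix_apply, Matrix.map_apply, Matrix.of_apply, map_pow]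
    rw [killVar_xV_of_ne]
    exact fun e => hk (e ▸ orderEmbOfFin_mem C h a)
  · exact map_zero _

theorem sort_insert_of_forall_lt {S : Finset ℕ} {k : ℕ} (h : ∀ s ∈ S, s < k) :
    (insert k S).sort (· ≤ ·) = S.sort (· ≤ ·) ++ [k] := by
  have hk : k ∉ S := fun hk => (h k hk).false
  refine List.Perm.eq_of_pairwise' (r := (· ≤ ·)) (pairwise_sort _ _) ?_ ?_
  · refine List.pairwise_append.2 ⟨pairwise_sort _ _, List.pairwise_singleton _ _, ?_⟩
    simpa using fun s hs => (h s hs).le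
  · rw [List.perm_ext_iff_of_nodup (sort_nodup _ _)]
    · simp [or_comm]
    · refine List.nodup_append.2 ⟨sort_nodup _ _, List.nodup_singleton _, ?_⟩
      simpa using fun s hs => (h s hs).ne

theorem yProd_insert_of_forall_lt (F : Type) [Field F] (n : ℕ) {S : Finset ℕ} {k : ℕ}
    (h : ∀ s ∈ S, s < k) : yProd F n (insert k S) = yProd F n S * yV F n k := by
  simp [yProd, sort_insert_of_forall_lt h]

theorem range_succ_sdiff_insert (k : ℕ) (S : Finset ℕ) :
    range (k + 1) \ insert k S = range k \ S := by
  ext a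
  simp only [mem_sdiff, mem_range, mem_insert]
  grind

theorem map_killVar_MuiM_insert (F : Type) [Field F] {q n k : ℕ} (hq : q ≠ 0)
    {B : Finset ℕ} (hB : B ⊆ range k) :
    Algebra.TensorProduct.map (killVar F n k) (AlgHom.id F (LV F n))
        (MuiM F q n (k + 1) (insert k B)) =
      ((-1 : F) ^ (k + B.card)) • (MuiM F q n k B * ((1 : SV F n) ⊗ₜ[F] yV F n k)) := by
  have hkB : k ∉ B := fun h => by simpa using hB h
  have hlt : ∀ {S}, S ∈ (range k).powersetCard B.card → ∀ s ∈ S, s < k := fun hS s hs =>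
    mem_range.1 ((mem_powersetCard.1 hS).1 hs)
  have hk : ∀ {c S}, S ∈ (range k).powersetCard c → k ∉ S := fun hS h => by
    simpa using (mem_powersetCard.1 hS).1 h
  have hsign : B.card * (B.card + 1) / 2 + B.card + 1 = (B.card + 1) * (B.card + 2) / 2 := by
    rw [show (B.card + 1) * (B.card + 2) = B.card * (B.card + 1) + (B.card + 1) * 2 by ring,
      Nat.add_mul_div_right _ _ two_pos, add_assoc]
  unfold MuiM
  rw [card_insert_of_notMem hkB, range_add_one, powersetCard_succ_insert notMem_range_self,
    sum_union, map_add, map_sum, sum_eq_zero, zero_add, sum_image, map_sum, sum_mul, smul_sum,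
    ← range_add_one]
  · refine sum_congr rfl fun S hS => ?_
    rw [map_smul, Algebra.TensorProduct.map_tmul, range_succ_sdiff_insert,
      range_succ_sdiff_insert, killVar_subDet_of_notMem _ _ (by simp),
      yProd_insert_of_forall_lt F n (hlt hS), sum_insert (hk hS), smul_mul_assoc,
      Algebra.TensorProduct.tmul_mul_tmul, mul_one, smul_smul, ← pow_add, AlgHom.id_apply]
    congr 1
    rw [← hsign, show B.card * (B.card + 1) / 2 + B.card + 1 + (k + ∑ s ∈ S, s) + (B.card + 1) =
      k + B.card + (B.card * (B.card + 1) / 2 + ∑ s ∈ S, s + B.card) + 2 by ring,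
      pow_add _ _ 2, neg_one_sq, mul_one]
  · intro S hS T hT hST
    rw [← erase_insert (hk hS), ← erase_insert (hk hT), hST]
  · intro S hS
    rw [map_smul, Algebra.TensorProduct.map_tmul, killVar_subDet_of_mem F hq, TensorProduct.zero_tmul,
      smul_zero]
    exact mem_sdiff.2 ⟨mem_insert_self _ _, hk hS⟩
  · rw [disjoint_left]
    intro S hS hS'
    obtain ⟨T, -, rfl⟩ := mem_image.1 hS'
    exact hk hS (mem_insert_self _ _)

/-- **Lemma 2.6** (Minh–Tùng, Corollary 1; general `q`). Let `φ` be the algebra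
endomorphism of `S(V) ⊗ Λ(V)` with `φ(x_m) = 0`, `φ(x_i) = x_i` for `i ≠ m` and
`φ(y_i) = y_i`. For `1 ≤ j ≤ m ≤ n` and `0 ≤ b_1 < ⋯ < b_{j−1} < m−1`:
`φ(M_{m;b_1,…,b_{j−1},m−1}) = (−1)^{m+j} M_{m−1;b_1,…,b_{j−1}} y_m`. -/
theorem minh_tung_substitution
    (F : Type) [Field F] [Fintype F] (p r q n m j : ℕ)
    (hp : p.Prime) (hr : 0 < r) (hq : q = p ^ r) (hF : Fintype.card F = q)
    (hj : 1 ≤ j) (hjm : j ≤ m) (hmn : m ≤ n)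
    (b : Fin (j - 1) → ℕ) (hb : StrictMono b) (hbm : ∀ i, b i < m - 1) :
    Algebra.TensorProduct.map
        (MvPolynomial.aeval fun i : Fin n =>
          if (i : ℕ) = m - 1 then 0 else MvPolynomial.X i)
        (AlgHom.id F (LV F n))
        (MuiM F q n m (insert (m - 1) (Finset.image b Finset.univ)))
      = ((-1 : F) ^ (m + j)) •
          (MuiM F q n (m - 1) (Finset.image b Finset.univ) *
            ((1 : SV F n) ⊗ₜ[F] yV F n (m - 1))) := by
  obtain ⟨k, rfl⟩ : ∃ k, m = k + 1 := ⟨m - 1, by omega⟩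
  have hB : Finset.image b Finset.univ ⊆ range k := by
    intro a ha
    obtain ⟨i, -, rfl⟩ := mem_image.1 ha
    exact mem_range.2 (hbm i)
  have hcard : (Finset.image b Finset.univ).card = j - 1 := by
    rw [card_image_of_injective _ hb.injective, card_univ, Fintype.card_fin]
  have hq0 : q ≠ 0 := hq ▸ pow_ne_zero r hp.ne_zero
  have hsign : (-1 : F) ^ (k + 1 + j) = (-1) ^ (k + (Finset.image b Finset.univ).card) := by
    rw [hcard, show k + 1 + j = k + (j - 1) + 2 by omega, pow_add _ _ 2, neg_one_sq, mul_one]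
  rw [hsign]
  exact map_killVar_MuiM_insert F hq0 hB
end
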